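/- Assume S : G → F is surjective and its restriction to (ker S)ᗮ is an isometry onto F (‖S h‖ = ‖h‖ for all h ∈ (ker S)ᗮ). Let W = { (x, g) ∈ E × G : T x = S g }. Then the map id_E × S : E × G → E × F restricts to a norm-preserving linear bijection from the orthogonal complement Wᗮ onto the orthogonal complement (graph T)ᗮ of the graph of T in E × F. -/

import Mathlib

open scoped InnerProductSpace

section HorizontalIsometry

variable {F G : Type*} [NormedAddCommGroup F] [InnerProductSpace ℝ F]
  [NormedAddCommGroup G] [InnerProductSpace ℝ G] [FiniteDimensional ℝ G]

/-- Every vector agrees modulo `ker S` with a vector of the horizontal subspace `(ker S)ᗮ`. -/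
theorem LinearMap.exists_mem_orthogonal_ker_sub_mem_ker (S : G →ₗ[ℝ] F) (g : G) :
    ∃ h ∈ (LinearMap.ker S)ᗮ, g - h ∈ LinearMap.ker S := by
  obtain ⟨k, hk, h, hh, rfl⟩ := (LinearMap.ker S).exists_add_mem_mem_orthogonal g
  exact ⟨h, hh, by simpa using hk⟩

/-- If `S` is isometric on `(ker S)ᗮ`, it preserves inner products with horizontal vectors. -/
theorem LinearMap.inner_map_map_of_mem_orthogonal_ker {S : G →ₗ[ℝ] F}
    (hS : ∀ h ∈ (LinearMap.ker S)ᗮ, ‖S h‖ = ‖h‖) {h : G} (hh : h ∈ (LinearMap.ker S)ᗮ) (g : G) :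
    ⟪S h, S g⟫_ℝ = ⟪h, g⟫_ℝ := by
  obtain ⟨h', hh', hk⟩ := S.exists_mem_orthogonal_ker_sub_mem_ker g
  have hSg : S g = S h' := LinearMap.sub_mem_ker_iff.mp hk
  have hhg : ⟪h, g⟫_ℝ = ⟪h, h'⟫_ℝ := by
    rw [← sub_eq_zero, ← inner_sub_right]
    exact Submodule.inner_left_of_mem_orthogonal hk hh
  rw [hSg, hhg]
  exact (LinearMap.norm_map_iff_inner_map_map (S.domRestrict (LinearMap.ker S)ᗮ)).mp
    (fun x => hS x x.2) ⟨h, hh⟩ ⟨h', hh'⟩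

end HorizontalIsometry

/-- Assume `S : G → F` is surjective and restricts to an isometry of `(ker S)ᗮ` onto `F`.
Let `W = {(x, g) ∈ E × G : T x = S g}`. Then `id_E × S` restricts to a norm-preserving
linear bijection from `Wᗮ` onto `(graph T)ᗮ`. (Products carry the sum inner product,
modeled by `WithLp 2`.) -/
theorem idProdS_restrict_bijection_orthogonal_complements
    {E F G : Type*} [NormedAddCommGroup E] [InnerProductSpace ℝ E] [FiniteDimensional ℝ E]
    [NormedAddCommGroup F] [InnerProductSpace ℝ F] [FiniteDimensional ℝ F]
    [NormedAddCommGroup G] [InnerProductSpace ℝ G] [FiniteDimensional ℝ G]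
    (T : E →ₗ[ℝ] F) (S : G →ₗ[ℝ] F)
    (hS : Function.Surjective S)
    (hSiso : ∀ h ∈ (LinearMap.ker S)ᗮ, ‖S h‖ = ‖h‖)
    (eG : WithLp 2 (E × G) ≃ₗ[ℝ] E × G) (heG : eG = WithLp.linearEquiv 2 ℝ (E × G))
    (eF : WithLp 2 (E × F) ≃ₗ[ℝ] E × F) (heF : eF = WithLp.linearEquiv 2 ℝ (E × F))
    (W : Submodule ℝ (WithLp 2 (E × G)))
    (hW : ∀ v : WithLp 2 (E × G), v ∈ W ↔ T (eG v).1 = S (eG v).2)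
    (Φ : WithLp 2 (E × G) →ₗ[ℝ] WithLp 2 (E × F))
    (hΦ : ∀ v : WithLp 2 (E × G), Φ v = eF.symm ((eG v).1, S (eG v).2)) :
    Set.InjOn Φ (Wᗮ : Set (WithLp 2 (E × G))) ∧
    Submodule.map Φ Wᗮ = ((LinearMap.graph T).comap eF.toLinearMap)ᗮ ∧
    (∀ v ∈ Wᗮ, ‖Φ v‖ = ‖v‖) := by
  subst heG heF
  have snd_mem : ∀ v ∈ Wᗮ, v.snd ∈ (LinearMap.ker S)ᗮ := by
    intro v hv k hk
    have hkW : WithLp.toLp 2 ((0 : E), k) ∈ W := (hW _).mpr (by simpa using hk.symm)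
    simpa [WithLp.prod_inner_apply] using hv _ hkW
  have norm_eq : ∀ v ∈ Wᗮ, ‖Φ v‖ = ‖v‖ := by
    intro v hv
    rw [hΦ, WithLp.prod_norm_eq_of_L2, WithLp.prod_norm_eq_of_L2]
    simp [hSiso _ (snd_mem v hv)]
  refine ⟨?_, ?_, norm_eq⟩
  · intro v hv w hw hvw
    rw [← sub_eq_zero, ← norm_eq_zero, ← norm_eq _ (sub_mem hv hw), map_sub, hvw, sub_self,
      norm_zero]
  · ext u
    constructor
    · rintro ⟨v, hv, rfl⟩ w hw
      obtain ⟨g, hg⟩ := hS w.snd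
      have hwT : w.snd = T w.fst := by simpa [LinearMap.mem_graph_iff] using hw
      have hgW : WithLp.toLp 2 (w.fst, g) ∈ W := (hW _).mpr (by simp [hg, hwT])
      have h := hv _ hgW
      rw [real_inner_comm] at h ⊢
      simpa [hΦ, WithLp.prod_inner_apply, ← hg,
        LinearMap.inner_map_map_of_mem_orthogonal_ker hSiso (snd_mem v hv)] using h
    · intro hu
      obtain ⟨g, hg⟩ := hS u.snd
      obtain ⟨h, hh, hk⟩ := S.exists_mem_orthogonal_ker_sub_mem_ker g
      have hSh : S h = u.snd := (LinearMap.sub_mem_ker_iff.mp hk).symm.trans hg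
      refine ⟨WithLp.toLp 2 (u.fst, h), fun w hw => ?_, ?_⟩
      · have hwT : T w.fst = S w.snd := by simpa using (hW w).mp hw
        have huw := hu (WithLp.toLp 2 (w.fst, T w.fst)) (by simp [LinearMap.mem_graph_iff])
        rw [real_inner_comm] at huw ⊢
        simpa [WithLp.prod_inner_apply, hwT, ← hSh,
          LinearMap.inner_map_map_of_mem_orthogonal_ker hSiso hh] using huw
      · rw [hΦ]
        apply (WithLp.linearEquiv 2 ℝ (E × F)).injective
        ext <;> simp [hSh]
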